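/- arXiv:2310.05948 — 8 statements merged into one kernel-verified Lean document; each statement's English description precedes it below -/
import Mathlib

section
/- Let R be a (left) nearfield that is proper, i.e. there exist α, β, γ ∈ R with (α + β)·γ ≠ α·γ + β·γ. Let n ≥ 1 and let M : Fin n → Fin n → R be a matrix over R, with induced map f_M : (Fin n → R) → (Fin n → R) defined by f_M x i = ∑ j, M i j · x j. Then f_M is linear, i.e. f_M (fun j => x j · r) = (fun i => (f_M x i) · r) for all x : Fin n → R and r ∈ R, if and only if every row of M has at most one nonzero entry (for every i, whenever M i j₁ ≠ 0 and M i j₂ ≠ 0 then j₁ = j₂). -/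
/-- For a proper (left) nearfield `R`, the map induced by a matrix
`M : Fin n → Fin n → R` via `f_M x i = ∑ j, M i j * x j` is linear (commutes with right
scalar multiplication) iff every row of `M` has at most one nonzero entry. -/
theorem linear_iff_row_has_at_most_one_nonzero
    {R : Type*} [AddCommGroup R] [Mul R] [One R] [Inv R]
    (hassoc : ∀ a b c : R, a * (b * c) = a * b * c)
    (hone_ne_zero : (1 : R) ≠ 0)
    (hone_mul : ∀ a : R, 1 * a = a) (hmul_one : ∀ a : R, a * 1 = a)
    (hzero_mul : ∀ a : R, (0 : R) * a = 0) (hmul_zero : ∀ a : R, a * (0 : R) = 0)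
    (hinv : ∀ a : R, a ≠ 0 → a * a⁻¹ = 1 ∧ a⁻¹ * a = 1)
    (hldistrib : ∀ a b c : R, a * (b + c) = a * b + a * c)
    (hproper : ∃ α β γ : R, (α + β) * γ ≠ α * γ + β * γ)
    {n : ℕ} (hn : 1 ≤ n) (M : Fin n → Fin n → R) :
    (∀ (x : Fin n → R) (r : R),
        (fun i => ∑ j, M i j * (x j * r)) = (fun i => (∑ j, M i j * x j) * r)) ↔
      (∀ i j₁ j₂, M i j₁ ≠ 0 → M i j₂ ≠ 0 → j₁ = j₂) := by
  constructor
  · intro hlin i j₁ j₂ h₁ h₂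
    by_contra hne
    obtain ⟨α, β, γ, hαβγ⟩ := hproper
    have hne' : j₂ ≠ j₁ := fun h => hne h.symm
    have key := congrFun (hlin (fun j => if j = j₁ then (M i j₁)⁻¹ * α
      else if j = j₂ then (M i j₂)⁻¹ * β else 0) γ) i
    have hsupp : ∀ j, j ≠ j₁ ∧ j ≠ j₂ → (if j = j₁ then (M i j₁)⁻¹ * α
        else if j = j₂ then (M i j₂)⁻¹ * β else 0) = 0 := fun j hj => by
      rw [if_neg hj.1, if_neg hj.2]
    beta_reduce at key
    rw [Fintype.sum_eq_add j₁ j₂ hne (fun j hj => by rw [hsupp j hj, hzero_mul, hmul_zero]),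
      Fintype.sum_eq_add j₁ j₂ hne (fun j hj => by rw [hsupp j hj, hmul_zero]),
      if_pos rfl, if_neg hne', if_pos rfl, hassoc, hassoc, hassoc, hassoc,
      (hinv _ h₁).1, (hinv _ h₂).1, hone_mul, hone_mul] at key
    exact hαβγ key.symm
  · intro hrow x r
    funext i
    by_cases h : ∃ j₀, M i j₀ ≠ 0
    · obtain ⟨j₀, hj₀⟩ := h
      have hz : ∀ j, j ≠ j₀ → M i j = 0 := fun j hj => by
        by_contra hM
        exact hj (hrow i j j₀ hM hj₀)
      rw [Fintype.sum_eq_single j₀ (fun j hj => by rw [hz j hj, hzero_mul]),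
        Fintype.sum_eq_single j₀ (fun j hj => by rw [hz j hj, hzero_mul]), hassoc]
    · push Not at h
      simp only [h, hzero_mul, Finset.sum_const_zero]
end

section
/- Let R be a (left) nearfield that is proper, i.e. there exist α, β, γ ∈ R with (α + β)·γ ≠ α·γ + β·γ. Let n ≥ 1 and let M : Fin n → Fin n → R be a matrix each of whose rows has at most one nonzero entry, with induced (linear) map f_M x i = ∑ j, M i j · x j. Then the image of f_M is a submodule of R^n — meaning that for all m : Fin n → R, all y in the range of f_M, and all r ∈ R, the vector (fun i => (m i + y i)·r − (m i)·r) again lies in the range of f_M — if and only if every column of M also has at most one nonzero entry (for every j, whenever M i₁ j ≠ 0 and M i₂ j ≠ 0 then i₁ = i₂). -/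
/-- If row `i` of `M` has its only nonzero entry in column `j`, then coordinate `i` of the
induced map picks out the single term `M i j * x j`. -/
theorem sum_mul_eq_of_row_unique {R ι κ : Type*} [AddCommMonoid R] [Mul R] [Fintype κ]
    (hzero_mul : ∀ a : R, (0 : R) * a = 0) {M : ι → κ → R}
    (hrow : ∀ i j₁ j₂, M i j₁ ≠ 0 → M i j₂ ≠ 0 → j₁ = j₂)
    {i : ι} {j : κ} (hij : M i j ≠ 0) (x : κ → R) :
    ∑ k, M i k * x k = M i j * x j := by
  refine Finset.sum_eq_single_of_mem j (Finset.mem_univ j) fun k _ hk => ?_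
  have hik : M i k = 0 := by
    by_contra h
    exact hk (hrow i k j h hij)
  rw [hik, hzero_mul]


/-- For a proper (left) nearfield `R` and a matrix `M` each of whose rows has
at most one nonzero entry (so that `f_M` is linear), the image of `f_M` is a submodule of
`R^n` iff every column of `M` has at most one nonzero entry. -/
theorem normal_iff_column_has_at_most_one_nonzero
    {R : Type*} [AddCommGroup R] [Mul R] [One R] [Inv R]
    (hassoc : ∀ a b c : R, a * (b * c) = a * b * c)
    (hone_ne_zero : (1 : R) ≠ 0)
    (hone_mul : ∀ a : R, 1 * a = a) (hmul_one : ∀ a : R, a * 1 = a)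
    (hzero_mul : ∀ a : R, (0 : R) * a = 0) (hmul_zero : ∀ a : R, a * (0 : R) = 0)
    (hinv : ∀ a : R, a ≠ 0 → a * a⁻¹ = 1 ∧ a⁻¹ * a = 1)
    (hldistrib : ∀ a b c : R, a * (b + c) = a * b + a * c)
    (hproper : ∃ α β γ : R, (α + β) * γ ≠ α * γ + β * γ)
    {n : ℕ} (hn : 1 ≤ n) (M : Fin n → Fin n → R)
    (hrow : ∀ i j₁ j₂, M i j₁ ≠ 0 → M i j₂ ≠ 0 → j₁ = j₂) :
    (∀ (m y : Fin n → R) (r : R),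
        y ∈ Set.range (fun x : Fin n → R => fun i => ∑ j, M i j * x j) →
        (fun i => (m i + y i) * r - m i * r) ∈
          Set.range (fun x : Fin n → R => fun i => ∑ j, M i j * x j)) ↔
      (∀ j i₁ i₂, M i₁ j ≠ 0 → M i₂ j ≠ 0 → i₁ = i₂) := by
  have hsum {i j : Fin n} (hij : M i j ≠ 0) (x : Fin n → R) :
      ∑ k, M i k * x k = M i j * x j :=
    sum_mul_eq_of_row_unique hzero_mul hrow hij x
  have cancel {a b c : R} (ha : a ≠ 0) (h : a * b = a * c) : b = c := by
    rw [← hone_mul b, ← hone_mul c, ← (hinv a ha).2, ← hassoc, ← hassoc, h]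
  have mul_sub' (a b c : R) : a * (b - c) = a * b - a * c := by
    rw [eq_sub_iff_add_eq, ← hldistrib, sub_add_cancel]
  constructor
  · intro hnormal j i₁ i₂ h₁ h₂
    by_contra hne
    obtain ⟨α, β, γ, hαβγ⟩ := hproper
    obtain ⟨x, hx⟩ := hnormal (Function.update 0 i₁ (M i₁ j * α)) _ γ ⟨fun _ => β, rfl⟩
    have e₁ := congrFun hx i₁
    have e₂ := congrFun hx i₂
    simp only [hsum h₁, Function.update_self] at e₁
    simp only [hsum h₂, Function.update_of_ne (Ne.symm hne), Pi.zero_apply, zero_add,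
      hzero_mul, sub_zero] at e₂
    rw [← hldistrib, ← hassoc, ← hassoc, ← mul_sub'] at e₁
    rw [← hassoc] at e₂
    have h := (cancel h₁ e₁).symm.trans (cancel h₂ e₂)
    exact hαβγ (by rw [sub_eq_iff_eq_add.mp h, add_comm])
  · rintro hcol m y r ⟨x, rfl⟩
    classical
    set v : Fin n → R := fun i => (m i + ∑ j, M i j * x j) * r - m i * r
    refine ⟨fun j => if h : ∃ i, M i j ≠ 0 then (M h.choose j)⁻¹ * v h.choose else 0, ?_⟩
    funext i
    by_cases hi : ∃ j, M i j ≠ 0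
    · obtain ⟨j, hij⟩ := hi
      have hex : ∃ i, M i j ≠ 0 := ⟨i, hij⟩
      have hchoose : hex.choose = i := hcol j _ _ hex.choose_spec hij
      dsimp only
      rw [hsum hij, dif_pos hex, hchoose, hassoc, (hinv _ hij).1, hone_mul]
    · push Not at hi
      simp [v, hi, hzero_mul]
end

section
/- Let R be a (left) nearfield, let k ≥ 1 and m ≥ 1, and let v : Fin k → (Fin m → R) be a family of vectors in R^m. Suppose α, β : Fin k → R are two coefficient vectors with (fun j => ∑ i, v i j · α i) = (fun j => ∑ i, v i j · β i), and suppose α i₀ ≠ β i₀ for some index i₀. Then v i₀ = (fun j => (∑ i in Finset.univ \ {i₀}, v i j · (β i − α i)) · (α i₀ − β i₀)⁻¹); in particular v i₀ lies in LC₂ of the remaining vectors, so the family is 2-linearly dependent. -/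
/-- `LC₁(v)`: the set of all right linear combinations `∑ vᵢ·αᵢ` of the family `v`. -/
def LC1 {R : Type*} [AddCommMonoid R] [Mul R] {m : ℕ} {ι : Type*} [Fintype ι]
    (v : ι → (Fin m → R)) : Set (Fin m → R) :=
  { x | ∃ α : ι → R, x = fun j => ∑ i, v i j * α i }

/-- `LC₂(v)`: the set of all finite sums `∑ uₗ·λₗ` with each `uₗ ∈ LC₁(v)`. -/
def LC2 {R : Type*} [AddCommMonoid R] [Mul R] {m : ℕ} {ι : Type*} [Fintype ι]
    (v : ι → (Fin m → R)) : Set (Fin m → R) :=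
  { x | ∃ (ℓ : ℕ) (u : Fin ℓ → (Fin m → R)) (c : Fin ℓ → R),
      (∀ l, u l ∈ LC1 v) ∧ x = fun j => ∑ l, u l j * c l }

theorem mul_sub_of_left_distrib {R : Type*} [AddCommGroup R] [Mul R]
    (hldistrib : ∀ a b c : R, a * (b + c) = a * b + a * c) (a b c : R) :
    a * (b - c) = a * b - a * c :=
  map_sub (AddMonoidHom.mk' (a * ·) (hldistrib a)) b c

/-- If two coefficient vectors give the same linear combination, the part of the difference
outside `i₀` is the opposite of the term at `i₀`. -/
theorem sum_sdiff_mul_sub_eq {R ι : Type*} [AddCommGroup R] [Mul R] [Fintype ι] [DecidableEq ι]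
    (hldistrib : ∀ a b c : R, a * (b + c) = a * b + a * c)
    (x α β : ι → R) (heq : ∑ i, x i * α i = ∑ i, x i * β i) (i₀ : ι) :
    ∑ i ∈ Finset.univ \ {i₀}, x i * (β i - α i) = x i₀ * (α i₀ - β i₀) := by
  have hsum : ∑ i, x i * (β i - α i) = 0 := by
    simp only [mul_sub_of_left_distrib hldistrib, Finset.sum_sub_distrib, heq, sub_self]
  rw [Finset.sum_eq_sum_sdiff_singleton_add (Finset.mem_univ i₀)] at hsum
  rw [eq_neg_of_add_eq_zero_left hsum]
  simp only [mul_sub_of_left_distrib hldistrib, neg_sub]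

/-- Over a (left) nearfield `R`, if two distinct coefficient vectors `α, β`
give the same linear combination of the family `v`, differing at index `i₀`, then `v i₀`
is expressible from the remaining vectors; in particular `v i₀` lies in `LC₂` of the
remaining vectors, so the family is 2-linearly dependent. -/
theorem equal_combinations_give_two_linear_dependence
    {R : Type*} [AddCommGroup R] [Mul R] [One R] [Inv R]
    (hassoc : ∀ a b c : R, a * (b * c) = a * b * c)
    (hone_ne_zero : (1 : R) ≠ 0)
    (hone_mul : ∀ a : R, 1 * a = a) (hmul_one : ∀ a : R, a * 1 = a)
    (hzero_mul : ∀ a : R, (0 : R) * a = 0) (hmul_zero : ∀ a : R, a * (0 : R) = 0)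
    (hinv : ∀ a : R, a ≠ 0 → a * a⁻¹ = 1 ∧ a⁻¹ * a = 1)
    (hldistrib : ∀ a b c : R, a * (b + c) = a * b + a * c)
    {k m : ℕ} (hk : 1 ≤ k) (hm : 1 ≤ m)
    (v : Fin k → (Fin m → R)) (α β : Fin k → R)
    (heq : (fun j => ∑ i, v i j * α i) = (fun j => ∑ i, v i j * β i))
    (i₀ : Fin k) (hdiff : α i₀ ≠ β i₀) :
    v i₀ = (fun j => (∑ i ∈ Finset.univ \ {i₀}, v i j * (β i - α i)) * (α i₀ - β i₀)⁻¹) ∧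
    v i₀ ∈ LC2 (fun i' : {i : Fin k // i ≠ i₀} => v i'.1) := by
  have hv : v i₀ =
      (fun j => (∑ i ∈ Finset.univ \ {i₀}, v i j * (β i - α i)) * (α i₀ - β i₀)⁻¹) := by
    funext j
    rw [sum_sdiff_mul_sub_eq hldistrib (fun i => v i j) α β (congrFun heq j) i₀, ← hassoc,
      (hinv _ (sub_ne_zero.mpr hdiff)).1, hmul_one]
  refine ⟨hv, 1, fun _ j => ∑ i : {i : Fin k // i ≠ i₀}, v i j * (β i - α i),
    fun _ => (α i₀ - β i₀)⁻¹, fun _ => ⟨fun i => β i - α i, rfl⟩, hv.trans ?_⟩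
  funext j
  rw [Fin.sum_univ_one, Finset.sum_subtype (p := (· ≠ i₀)) (Finset.univ \ {i₀}) (by simp)]
end

section
/- Let R be a finite (left) nearfield with |R| = t, let k ≥ 1 and m ≥ 1, and let v : Fin k → (Fin m → R) be a family of vectors in R^m. Let LC₁(v) = { x : Fin m → R | ∃ α : Fin k → R, x = fun j => ∑ i, v i j · α i }. Then the cardinality of LC₁(v) is at most t^k. Moreover, if v is 2-linearly independent — meaning that for no index i does v i belong to LC₂ of the family (v restricted to the indices different from i), where LC₂ of a family w is the set of all finite sums ∑_l u_l·λ_l with each u_l ∈ LC₁(w) and λ_l ∈ R — then the map α ↦ (fun j => ∑ i, v i j · α i) is injective, the cardinality of LC₁(v) equals t^k, and k ≤ m. -/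
/-- If `∑ vᵢ·γᵢ = 0` and `γᵢ` has a right inverse `d`, then `vᵢ` is a scalar multiple of a
linear combination of the remaining vectors. -/
theorem mem_LC2_ne_of_sum_mul_eq_zero {R : Type*} [AddCommGroup R] [Mul R] {m : ℕ}
    {ι : Type*} [Fintype ι] [DecidableEq ι]
    (hassoc : ∀ a b c : R, a * (b * c) = a * b * c)
    (hmul_neg : ∀ a b : R, a * -b = -(a * b))
    (v : ι → (Fin m → R)) (γ : ι → R) (hγ : ∀ j, ∑ i, v i j * γ i = 0)
    (i : ι) (d : R) (hd : ∀ a : R, a * (γ i * d) = a) :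
    v i ∈ LC2 (fun i' : {i' : ι // i' ≠ i} => v i'.1) := by
  refine ⟨1, fun _ j => v i j * γ i, fun _ => d, fun _ => ⟨fun i' => -γ i'.1, ?_⟩, ?_⟩
  · funext j
    have h := hγ j
    rw [Fintype.sum_eq_add_sum_subtype_ne _ i] at h
    simpa only [hmul_neg, Finset.sum_neg_distrib] using eq_neg_of_add_eq_zero_left h
  · funext j
    simp [← hassoc, hd]

/-- Over a finite (left) nearfield `R` of cardinality `t`, for a family
`v : Fin k → R^m` one has `|LC₁(v)| ≤ t^k`; moreover if `v` is 2-linearly independent then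
the combination map is injective, `|LC₁(v)| = t^k`, and `k ≤ m`. -/
theorem card_LC1_le_and_eq_of_two_linearly_independent
    {R : Type*} [AddCommGroup R] [Mul R] [One R] [Inv R] [Fintype R]
    (hassoc : ∀ a b c : R, a * (b * c) = a * b * c)
    (hone_ne_zero : (1 : R) ≠ 0)
    (hone_mul : ∀ a : R, 1 * a = a) (hmul_one : ∀ a : R, a * 1 = a)
    (hzero_mul : ∀ a : R, (0 : R) * a = 0) (hmul_zero : ∀ a : R, a * (0 : R) = 0)
    (hinv : ∀ a : R, a ≠ 0 → a * a⁻¹ = 1 ∧ a⁻¹ * a = 1)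
    (hldistrib : ∀ a b c : R, a * (b + c) = a * b + a * c)
    (t : ℕ) (ht : Fintype.card R = t)
    {k m : ℕ} (hk : 1 ≤ k) (hm : 1 ≤ m) (v : Fin k → (Fin m → R)) :
    Set.ncard (LC1 v) ≤ t ^ k ∧
    ((∀ i : Fin k, v i ∉ LC2 (fun i' : {i' : Fin k // i' ≠ i} => v i'.1)) →
      Function.Injective (fun α : Fin k → R => fun j => ∑ i, v i j * α i) ∧
      Set.ncard (LC1 v) = t ^ k ∧ k ≤ m) := by
  have hmul_neg (a b : R) : a * -b = -(a * b) := by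
    rw [eq_neg_iff_add_eq_zero, ← hldistrib, neg_add_cancel, hmul_zero]
  have hrange : LC1 v = Set.range (fun α : Fin k → R => fun j => ∑ i, v i j * α i) := by
    ext x
    simp only [LC1, Set.mem_ofPred_eq, Set.mem_range, eq_comm]
  have hcard (n : ℕ) : Nat.card (Fin n → R) = t ^ n := by
    simp [ht]
  constructor
  · rw [hrange, ← hcard, ← Set.image_univ, ← Set.ncard_univ]
    exact Set.ncard_image_le
  · intro hv
    have hinj : Function.Injective (fun α : Fin k → R => fun j => ∑ i, v i j * α i) := by
      intro α β hαβ
      by_contra hne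
      obtain ⟨i, hi⟩ := Function.ne_iff.mp hne
      refine hv i (mem_LC2_ne_of_sum_mul_eq_zero hassoc hmul_neg v (α - β) (fun j => ?_) i
        (α i - β i)⁻¹ fun a => ?_)
      · simp only [Pi.sub_apply, sub_eq_add_neg, hldistrib, hmul_neg,
          Finset.sum_add_distrib, Finset.sum_neg_distrib]
        rw [← sub_eq_add_neg, sub_eq_zero]
        exact congrFun hαβ j
      · rw [Pi.sub_apply, (hinv _ (sub_ne_zero.mpr hi)).1, hmul_one]
    refine ⟨hinj, ?_, ?_⟩
    · rw [hrange, ← hcard, ← Set.image_univ, Set.ncard_image_of_injective _ hinj, Set.ncard_univ]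
    · have ht1 : 1 < t := ht ▸ Fintype.one_lt_card_iff.mpr ⟨1, 0, hone_ne_zero⟩
      have hle := Nat.card_le_card_of_injective _ hinj
      rwa [hcard, hcard, Nat.pow_le_pow_iff_right ht1] at hle
end

section
/- Let R be a (left) nearfield, n ≥ 1, and j : Fin n. Let w_r, w_s : Fin n → R be two row vectors such that for every l < j either w_r l = 0 or w_s l = 0, and such that w_r j ≠ 0 and w_s j ≠ 0. Let α, β, λ ∈ R satisfy (α + β)·λ ≠ α·λ + β·λ. Put α' = (w_r j)⁻¹·α and β' = (w_s j)⁻¹·β, and define θ : Fin n → R by θ l = (w_r l · α' + w_s l · β')·λ − w_r l · (α'·λ) − w_s l · (β'·λ). Then θ l = 0 for every l < j, and θ j = (α + β)·λ − α·λ − β·λ ≠ 0. -/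
/-- The distributivity trick of the EGE algorithm. With
`α' = (w_r j)⁻¹·α`, `β' = (w_s j)⁻¹·β` and
`θ l = (w_r l·α' + w_s l·β')·λ − w_r l·(α'·λ) − w_s l·(β'·λ)`, the row `θ` vanishes in
all columns before `j` and `θ j = (α + β)·λ − α·λ − β·λ ≠ 0`. -/
theorem distributivity_trick
    {R : Type*} [AddCommGroup R] [Mul R] [One R] [Inv R]
    (hassoc : ∀ a b c : R, a * (b * c) = a * b * c)
    (hone_ne_zero : (1 : R) ≠ 0)
    (hone_mul : ∀ a : R, 1 * a = a) (hmul_one : ∀ a : R, a * 1 = a)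
    (hzero_mul : ∀ a : R, (0 : R) * a = 0) (hmul_zero : ∀ a : R, a * (0 : R) = 0)
    (hinv : ∀ a : R, a ≠ 0 → a * a⁻¹ = 1 ∧ a⁻¹ * a = 1)
    (hldistrib : ∀ a b c : R, a * (b + c) = a * b + a * c)
    {n : ℕ} (hn : 1 ≤ n) (j : Fin n) (wr ws : Fin n → R)
    (hbefore : ∀ l : Fin n, l < j → wr l = 0 ∨ ws l = 0)
    (hwr : wr j ≠ 0) (hws : ws j ≠ 0)
    (α β lam : R) (hproper : (α + β) * lam ≠ α * lam + β * lam) :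
    (∀ l : Fin n, l < j →
        (wr l * ((wr j)⁻¹ * α) + ws l * ((ws j)⁻¹ * β)) * lam -
          wr l * (((wr j)⁻¹ * α) * lam) - ws l * (((ws j)⁻¹ * β) * lam) = 0) ∧
    ((wr j * ((wr j)⁻¹ * α) + ws j * ((ws j)⁻¹ * β)) * lam -
        wr j * (((wr j)⁻¹ * α) * lam) - ws j * (((ws j)⁻¹ * β) * lam) =
      (α + β) * lam - α * lam - β * lam) ∧
    (α + β) * lam - α * lam - β * lam ≠ 0 := by
  have hcancel : ∀ a b : R, a ≠ 0 → a * (a⁻¹ * b) = b := fun a b ha => by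
    rw [hassoc, (hinv a ha).1, hone_mul]
  refine ⟨fun l hl => ?_, ?_, ?_⟩
  · rcases hbefore l hl with h | h <;> simp [h, hzero_mul, hassoc]
  · rw [hassoc (wr j) _ lam, hassoc (ws j) _ lam, hcancel _ _ hwr, hcancel _ _ hws]
  · rwa [sub_sub, sub_ne_zero]
end

section
/- Let q be a natural number with q ≥ 3 and define f : ℝ → ℝ by f(x) = ((q : ℝ) + Real.sqrt ((q : ℝ)^2 + 8·((q : ℝ) − 2)·x − 8·(q : ℝ) + 16) − 4) / (2·((q : ℝ) − 2)), and define u : ℕ → ℝ by u(j) = (((q : ℝ) − 2)·((j : ℝ) − 1) + 2)·(j : ℝ) / 2. Then: (1) f is strictly monotone increasing on [0, ∞); and (2) for every natural number k ≥ 1 and every natural number m with u(k − 1) < (m : ℝ) ≤ u(k), the ceiling of f(m) equals k, i.e. ⌈f((m : ℝ))⌉ = k. -/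
/-- The function `f(x) = (q + √(q² + 8(q − 2)x − 8q + 16) − 4) / (2(q − 2))`. -/
noncomputable def rowCountFun (q : ℕ) (x : ℝ) : ℝ :=
  ((q : ℝ) + Real.sqrt ((q : ℝ) ^ 2 + 8 * ((q : ℝ) - 2) * x - 8 * (q : ℝ) + 16) - 4) /
    (2 * ((q : ℝ) - 2))

/-- The sequence `u(j) = ((q − 2)·(j − 1) + 2)·j / 2` (as a real number). -/
noncomputable def maxDim (q : ℕ) (j : ℕ) : ℝ :=
  (((q : ℝ) - 2) * ((j : ℝ) - 1) + 2) * (j : ℝ) / 2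

theorem rowCountFun_strictMonoOn {q : ℕ} (hq : 3 ≤ q) :
    StrictMonoOn (rowCountFun q) (Set.Ici (0 : ℝ)) := by
  intro x hx y _ hxy
  have hq' : (3 : ℝ) ≤ q := by exact_mod_cast hq
  have hx : 0 ≤ x := hx
  have hprod : 0 ≤ ((q : ℝ) - 2) * x := mul_nonneg (by linarith) hx
  have hlt : ((q : ℝ) - 2) * x < ((q : ℝ) - 2) * y :=
    mul_lt_mul_of_pos_left hxy (by linarith)
  have hsqrt : Real.sqrt ((q : ℝ) ^ 2 + 8 * ((q : ℝ) - 2) * x - 8 * (q : ℝ) + 16) <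
      Real.sqrt ((q : ℝ) ^ 2 + 8 * ((q : ℝ) - 2) * y - 8 * (q : ℝ) + 16) :=
    Real.sqrt_lt_sqrt (by nlinarith [sq_nonneg ((q : ℝ) - 4)]) (by linarith)
  unfold rowCountFun
  exact div_lt_div_of_pos_right (by linarith) (by linarith)

theorem maxDim_nonneg {q : ℕ} (hq : 3 ≤ q) (j : ℕ) : 0 ≤ maxDim q j := by
  have hq' : (3 : ℝ) ≤ q := by exact_mod_cast hq
  unfold maxDim
  rcases Nat.eq_zero_or_pos j with rfl | hj
  · simp
  · have hj' : (1 : ℝ) ≤ j := by exact_mod_cast hj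
    have := mul_nonneg (show (0 : ℝ) ≤ q - 2 by linarith) (show (0 : ℝ) ≤ j - 1 by linarith)
    positivity

theorem rowCountFun_maxDim (q j : ℕ) :
    rowCountFun q (maxDim q j) =
      ((q : ℝ) + |2 * ((q : ℝ) - 2) * j - (q - 4)| - 4) / (2 * ((q : ℝ) - 2)) := by
  rw [rowCountFun, maxDim, ← Real.sqrt_sq_eq_abs]
  ring_nf

theorem le_rowCountFun_maxDim {q : ℕ} (hq : 3 ≤ q) (j : ℕ) :
    (j : ℝ) ≤ rowCountFun q (maxDim q j) := by
  have hq' : (3 : ℝ) ≤ q := by exact_mod_cast hq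
  rw [rowCountFun_maxDim, le_div_iff₀ (by linarith)]
  linarith [le_abs_self (2 * ((q : ℝ) - 2) * j - (q - 4))]

theorem rowCountFun_maxDim_of_pos {q j : ℕ} (hq : 3 ≤ q) (hj : 1 ≤ j) :
    rowCountFun q (maxDim q j) = j := by
  have hq' : (3 : ℝ) ≤ q := by exact_mod_cast hq
  have hj' : (1 : ℝ) ≤ j := by exact_mod_cast hj
  have hpos : (0 : ℝ) ≤ 2 * ((q : ℝ) - 2) * j - (q - 4) := by nlinarith
  rw [rowCountFun_maxDim, abs_of_nonneg hpos, div_eq_iff (by linarith)]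
  ring

/-- For `q ≥ 3`, the function `f` is strictly monotone increasing on
`[0, ∞)`, and for every `k ≥ 1` and every natural number `m` with
`u(k − 1) < m ≤ u(k)` one has `⌈f(m)⌉ = k`. -/
theorem rowCountFun_strictMono_and_ceil
    (q : ℕ) (hq : 3 ≤ q) :
    StrictMonoOn (rowCountFun q) (Set.Ici (0 : ℝ)) ∧
    ∀ k : ℕ, 1 ≤ k → ∀ m : ℕ,
      maxDim q (k - 1) < (m : ℝ) → (m : ℝ) ≤ maxDim q k →
      ⌈rowCountFun q (m : ℝ)⌉ = (k : ℤ) := by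
  have hmono := rowCountFun_strictMonoOn hq
  refine ⟨hmono, fun k hk m hlo hhi => ?_⟩
  have hm : (m : ℝ) ∈ Set.Ici (0 : ℝ) := Set.mem_Ici.mpr m.cast_nonneg
  rw [Int.ceil_eq_iff]
  constructor
  · have h := (le_rowCountFun_maxDim hq (k - 1)).trans_lt
      (hmono (maxDim_nonneg hq (k - 1)) hm hlo)
    simpa [Nat.cast_sub hk] using h
  · have h := hmono.monotoneOn hm (maxDim_nonneg hq k) hhi
    simpa [rowCountFun_maxDim_of_pos hq hk] using h
end

section
/- Let R be a type with an addition making (R,+) a group (commutativity NOT assumed), a zero, a one with 1 ≠ 0, and an associative multiplication satisfying: the left distributive law a·(b + c) = a·b + a·c for all a, b, c; 0·a = 0 for all a; 1·a = a and a·1 = a for all a; and every a ≠ 0 has some b with a·b = 1 and b·a = 1 (i.e. R is a (left) nearfield). Then addition on R is commutative: a + b = b + a for all a, b ∈ R. -/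
/-- The additive group of a (left) nearfield is abelian. Here `(R,+)` is
only assumed to be a group (not commutative), multiplication is associative with identity
`1 ≠ 0`, the LEFT distributive law holds, `0·a = 0`, and every nonzero element has a
two-sided multiplicative inverse. Then `a + b = b + a` for all `a, b ∈ R`. -/
theorem nearfield_add_comm
    {R : Type*} [AddGroup R] [Mul R] [One R]
    (hassoc : ∀ a b c : R, a * (b * c) = a * b * c)
    (hone_ne_zero : (1 : R) ≠ 0)
    (hldistrib : ∀ a b c : R, a * (b + c) = a * b + a * c)
    (hzero_mul : ∀ a : R, (0 : R) * a = 0)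
    (hone_mul : ∀ a : R, 1 * a = a) (hmul_one : ∀ a : R, a * 1 = a)
    (hinv : ∀ a : R, a ≠ 0 → ∃ b : R, a * b = 1 ∧ b * a = 1) :
    ∀ a b : R, a + b = b + a := by
  have hmul_zero (a : R) : a * 0 = 0 := by
    have h := hldistrib a 0 0
    rwa [add_zero, left_eq_add] at h
  have hmul_neg (a b : R) : a * -b = -(a * b) := by
    rw [eq_neg_iff_add_eq_zero, ← hldistrib, neg_add_cancel, hmul_zero]
  have hmul_neg_one (a : R) : a * -1 = -a := by rw [hmul_neg, hmul_one]
  -- It suffices that negation is additive.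
  suffices hneg : ∀ a b : R, -(a + b) = -a + -b by
    intro a b
    rw [← neg_inj, hneg, neg_add_rev]
  by_cases htwo : (1 + 1 : R) = 0
  · have hself (a : R) : -a = a := by
      rw [neg_eq_iff_add_eq_zero]
      simpa only [hldistrib, hmul_one, hmul_zero] using congrArg (a * ·) htwo
    intro a b
    rw [hself, hself, hself]
  -- Left multiplication by `-1` has no nonzero fixed point.
  have hfix (x : R) (hx : -1 * x = x) : x = 0 := by
    by_contra hx0
    obtain ⟨y, hxy, -⟩ := hinv x hx0
    have h : (-1 : R) = 1 := by
      calc (-1 : R) = -1 * (x * y) := by rw [hxy, hmul_one]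
        _ = 1 := by rw [hassoc, hx, hxy]
    exact htwo (neg_eq_iff_add_eq_zero.mp h)
  obtain ⟨t, htwo_t, ht_two⟩ := hinv _ htwo
  have ht : -1 * t = t * -1 := by
    calc -1 * t = t * ((1 + 1) * -1) * t := by rw [hassoc t, ht_two, hone_mul]
      _ = t * (-1 * (1 + 1)) * t := by
        rw [hmul_neg_one, hldistrib (-1), hmul_one, neg_add_rev]
      _ = t * -1 := by rw [hassoc t, ← hassoc, htwo_t, hmul_one]
  -- Left multiplication by `-1` is negation.
  have hneg_one_mul (c : R) : -1 * c = -c := by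
    set d := -c + -1 * c with hd
    have hd_neg : -1 * d = -d := by
      rw [hd, hldistrib, hassoc, hmul_neg_one, neg_neg, hone_mul, hmul_neg, neg_add_rev, neg_neg]
    have hy : -1 * (d * t) = -(d * t) := by
      rw [hassoc, hd_neg, ← hmul_neg_one d, ← hassoc, ht, hassoc, hmul_neg_one]
    have hyy : d * t + d * t = d := by
      calc d * t + d * t = d * t * (1 + 1) := by rw [hldistrib, hmul_one]
        _ = d := by rw [← hassoc, ht_two, hmul_one]
    have hc : -1 * c = c + d := by rw [hd, add_neg_cancel_left]
    have hcy : c + d * t = 0 := by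
      apply hfix
      rw [hldistrib, hy, hc, ← sub_eq_add_neg, sub_eq_iff_eq_add, add_assoc, hyy]
    rw [eq_neg_of_add_eq_zero_left hcy, hmul_neg, hy]
  intro a b
  rw [← hneg_one_mul, hldistrib, hneg_one_mul, hneg_one_mul]
end

section
/- Let R be a type with an addition making (R,+) a group (commutativity not assumed), an associative multiplication satisfying the left distributive law a·(b + c) = a·b + a·c, and a right identity e ≠ 0 (a·e = a for all a ∈ R). Call a subset A ⊆ R an R-subgroup if A is a subgroup of (R,+) and a·r ∈ A for all a ∈ A, r ∈ R. Then the nonzero elements of R form a group under multiplication (i.e. R is a division nearring) if and only if every R-subgroup of R equals {0} or R. -/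
/-- Beidleman's characterization of division nearrings. For a (left)
nearring `R` with a right identity `e ≠ 0`, the nonzero elements of `R` form a group
under multiplication iff every `R`-subgroup of `R` (an additive subgroup `A` with
`A·R ⊆ A`) equals `{0}` or `R`. -/
theorem division_nearring_iff_no_proper_rsubgroups
    {R : Type*} [AddGroup R] [Mul R] (e : R)
    (hassoc : ∀ a b c : R, a * (b * c) = a * b * c)
    (hldistrib : ∀ a b c : R, a * (b + c) = a * b + a * c)
    (he_ne : e ≠ 0) (hre : ∀ a : R, a * e = a) :
    ((∀ a b : R, a ≠ 0 → b ≠ 0 → a * b ≠ 0) ∧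
     (∀ a : R, a ≠ 0 → e * a = a) ∧
     (∀ a : R, a ≠ 0 → ∃ b : R, b ≠ 0 ∧ a * b = e ∧ b * a = e)) ↔
    (∀ A : AddSubgroup R, (∀ a ∈ A, ∀ r : R, a * r ∈ A) → A = ⊥ ∨ A = ⊤) := by
  have mul_zero' : ∀ a : R, a * 0 = 0 := fun a => by
    have h := hldistrib a 0 0
    rw [add_zero] at h
    exact left_eq_add.mp h
  constructor
  · rintro ⟨-, hle, hinv⟩ A hA
    rw [or_iff_not_imp_left, ← ne_eq, AddSubgroup.ne_bot_iff_exists_ne_zero]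
    rintro ⟨⟨a, ha⟩, ha0⟩
    obtain ⟨b, -, hab, -⟩ := hinv a fun h => ha0 (Subtype.ext h)
    have heA : e ∈ A := hab ▸ hA a ha b
    refine (AddSubgroup.eq_top_iff' A).mpr fun r => ?_
    rcases eq_or_ne r 0 with rfl | hr
    · exact A.zero_mem
    · exact hle r hr ▸ hA e heA r
  · intro H
    have hrange : ∀ a : R, (∀ r, a * r = 0) ∨ ∀ x, ∃ r, a * r = x := fun a => by
      let f : R →+ R := AddMonoidHom.mk' (a * ·) (hldistrib a)
      rcases H f.range (by rintro _ ⟨s, rfl⟩ r; exact ⟨s * r, hassoc a s r⟩) with h | h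
      · exact Or.inl fun r => AddSubgroup.mem_bot.mp (h ▸ ⟨r, rfl⟩ : f r ∈ (⊥ : AddSubgroup R))
      · exact Or.inr (AddMonoidHom.range_eq_top.mp h)
    have hsolve : ∀ a : R, a ≠ 0 → ∀ x, ∃ r, a * r = x := fun a ha =>
      (hrange a).resolve_left fun h => ha (hre a ▸ h e)
    have zero_mul' : ∀ r : R, 0 * r = 0 := (hrange 0).resolve_right fun h => by
      obtain ⟨c, hc⟩ := h e
      apply he_ne
      calc e = 0 * 0 * c := by rw [mul_zero', hc]
        _ = 0 * e := by rw [← hassoc, hc]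
        _ = 0 := hre 0
    have hle : ∀ a : R, e * a = a := fun a => by
      obtain ⟨r, rfl⟩ := hsolve e he_ne a
      rw [hassoc, hre]
    have hright : ∀ a : R, a ≠ 0 → ∃ b, b ≠ 0 ∧ a * b = e := fun a ha => by
      obtain ⟨b, hb⟩ := hsolve a ha e
      refine ⟨b, ?_, hb⟩
      rintro rfl
      exact he_ne (hb.symm.trans (mul_zero' a))
    refine ⟨fun a b ha hb hab => ?_, fun a _ => hle a, fun a ha => ?_⟩
    · obtain ⟨c, -, hc⟩ := hright b hb
      exact ha (by rw [← hre a, ← hc, hassoc, hab, zero_mul'])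
    · obtain ⟨b, hb, hab⟩ := hright a ha
      obtain ⟨c, -, hbc⟩ := hright b hb
      have hca : c = a := by rw [← hle c, ← hab, ← hassoc, hbc, hre]
      exact ⟨b, hb, hab, hca ▸ hbc⟩
end
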